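/- Let U ∈ J = H₃(O) with N_J(U) = 1, and define (X,Y)_U = (X,U#)(Y,U#) − (U,X,Y), where (·,·,·) is the symmetric trilinear form with (X,X,X) = 6N_J(X) and (Z,X#) = ½(Z,X,X). For U = E = [2,2,2;β,β,β], the quadratic form X ↦ (X,X)_E is positive-definite on J. -/

import Mathlib

open Quaternion

/-- Hamilton's rational quaternions. -/
abbrev H : Type := ℍ[ℚ]

/-- The octonions as the Cayley–Dickson double `H ⊕ H` with `γ = -1`. -/
abbrev O : Type := H × H

/-- Octonion multiplication: `(x₁,y₁)(x₂,y₂) = (x₁x₂ - y₂* y₁, y₂x₁ + y₁x₂*)`. -/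
def omul (z w : O) : O :=
  (z.1 * w.1 - star w.2 * z.2, w.2 * z.1 + z.2 * star w.1)

/-- Octonion conjugation `(x,y)* = (x*, -y)`. -/
def ostar (z : O) : O := (star z.1, -z.2)

/-- The unit octonion. -/
def oone : O := (1, 0)

/-- The positive-definite octonion norm `n((x,y)) = n_H(x) + n_H(y)`. -/
def onorm (z : O) : ℚ := normSq z.1 + normSq z.2

/-- The octonion trace `tr((x,y)) = tr_H(x)`. -/
def otr (z : O) : ℚ := (z.1 + star z.1).re

/-- The bilinear form `(x,y) = n(x+y) - n(x) - n(y)`. -/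
def obil (x y : O) : ℚ := onorm (x + y) - onorm x - onorm y

/-- The trilinear form `(x,y,z) = tr(x(yz))`. -/
def otri (x y z : O) : ℚ := otr (omul x (omul y z))

/-- Elements of `J = H₃(O)`, written `[c₁,c₂,c₃;x₁,x₂,x₃]`. -/
abbrev Jt : Type := ℚ × ℚ × ℚ × O × O × O

def mkJ (c₁ c₂ c₃ : ℚ) (x₁ x₂ x₃ : O) : Jt := (c₁, c₂, c₃, x₁, x₂, x₃)

/-- The cubic norm on `J = H₃(O)`. -/
def NJ : Jt → ℚ
  | (c₁, c₂, c₃, x₁, x₂, x₃) =>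
    c₁ * c₂ * c₃ - c₁ * onorm x₁ - c₂ * onorm x₂ - c₃ * onorm x₃ + otri x₁ x₂ x₃

/-- The trace pairing `(X,X')_I` on `J`. -/
def pairI : Jt → Jt → ℚ
  | (c₁, c₂, c₃, x₁, x₂, x₃), (d₁, d₂, d₃, y₁, y₂, y₃) =>
    c₁ * d₁ + c₂ * d₂ + c₃ * d₃ + obil x₁ y₁ + obil x₂ y₂ + obil x₃ y₃

/-- The adjoint `ι(X^#)`. -/
def sharpJ : Jt → Jt
  | (c₁, c₂, c₃, x₁, x₂, x₃) =>
    (c₂ * c₃ - onorm x₁, c₃ * c₁ - onorm x₂, c₁ * c₂ - onorm x₃,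
      ostar (omul x₂ x₃) - c₁ • x₁, ostar (omul x₃ x₁) - c₂ • x₂,
      ostar (omul x₁ x₂) - c₃ • x₃)

/-- The element `I = [1,1,1;0,0,0]`. -/
def IJ : Jt := mkJ 1 1 1 0 0 0

/-- The octonion `β = ½(-1+i+j+k, 1+i+j+k)`. -/
def βO : O := (⟨-1/2, 1/2, 1/2, 1/2⟩, ⟨1/2, 1/2, 1/2, 1/2⟩)

/-- The element `E = [2,2,2;β,β,β]`. -/
def EJ : Jt := mkJ 2 2 2 βO βO βO


/-- The symmetric trilinear form `(·,·,·)_J` on `J` with `(X,X,X)_J = 6 N_J(X)`,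
obtained by polarizing the cubic norm. -/
def triJ (X Y Z : Jt) : ℚ :=
  NJ (X + Y + Z) - NJ (X + Y) - NJ (Y + Z) - NJ (X + Z) + NJ X + NJ Y + NJ Z

/-- `(Z, X^#) = ½(Z,X,X)_J`. -/
def pairSharp (Z X : Jt) : ℚ := triJ Z X X / 2

/-- For `U` with `N_J(U) = 1`, the bilinear form `(X,Y)_U = (X,U^#)(Y,U^#) - (U,X,Y)_J`. -/
def pairU (U X Y : Jt) : ℚ := pairSharp X U * pairSharp Y U - triJ U X Y

/-- A weighted sum of squares with positive weights that is nonpositive vanishes termwise. -/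
theorem sum_sq_aux (t0 t1 t2 t3 t4 t5 t6 t7 t8 t9 t10 t11 t12 t13 t14 t15 t16 t17 t18 t19 t20 t21 t22 t23 t24 t25 t26 : ℚ)
    (h : 5 * t0 ^ 2
      + 24/5 * t1 ^ 2
      + 14/3 * t2 ^ 2
      + 32/7 * t3 ^ 2
      + 9/2 * t4 ^ 2
      + 40/9 * t5 ^ 2
      + 22/5 * t6 ^ 2
      + 48/11 * t7 ^ 2
      + 7/3 * t8 ^ 2
      + 16/7 * t9 ^ 2
      + 9/4 * t10 ^ 2
      + 20/9 * t11 ^ 2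
      + 11/5 * t12 ^ 2
      + 24/11 * t13 ^ 2
      + 13/6 * t14 ^ 2
      + 28/13 * t15 ^ 2
      + 9/7 * t16 ^ 2
      + 11/9 * t17 ^ 2
      + 13/11 * t18 ^ 2
      + 15/13 * t19 ^ 2
      + 17/15 * t20 ^ 2
      + 19/17 * t21 ^ 2
      + 21/19 * t22 ^ 2
      + 32/21 * t23 ^ 2
      + 3/8 * t24 ^ 2
      + 1/3 * t25 ^ 2
      + 1/4 * t26 ^ 2 ≤ 0) :
    t0 = 0 ∧ t1 = 0 ∧ t2 = 0 ∧ t3 = 0 ∧ t4 = 0 ∧ t5 = 0 ∧ t6 = 0 ∧ t7 = 0 ∧ t8 = 0 ∧ t9 = 0 ∧ t10 = 0 ∧ t11 = 0 ∧ t12 = 0 ∧ t13 = 0 ∧ t14 = 0 ∧ t15 = 0 ∧ t16 = 0 ∧ t17 = 0 ∧ t18 = 0 ∧ t19 = 0 ∧ t20 = 0 ∧ t21 = 0 ∧ t22 = 0 ∧ t23 = 0 ∧ t24 = 0 ∧ t25 = 0 ∧ t26 = 0 := by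
  have ht0 := sq_nonneg t0
  have ht1 := sq_nonneg t1
  have ht2 := sq_nonneg t2
  have ht3 := sq_nonneg t3
  have ht4 := sq_nonneg t4
  have ht5 := sq_nonneg t5
  have ht6 := sq_nonneg t6
  have ht7 := sq_nonneg t7
  have ht8 := sq_nonneg t8
  have ht9 := sq_nonneg t9
  have ht10 := sq_nonneg t10
  have ht11 := sq_nonneg t11
  have ht12 := sq_nonneg t12
  have ht13 := sq_nonneg t13
  have ht14 := sq_nonneg t14
  have ht15 := sq_nonneg t15
  have ht16 := sq_nonneg t16
  have ht17 := sq_nonneg t17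
  have ht18 := sq_nonneg t18
  have ht19 := sq_nonneg t19
  have ht20 := sq_nonneg t20
  have ht21 := sq_nonneg t21
  have ht22 := sq_nonneg t22
  have ht23 := sq_nonneg t23
  have ht24 := sq_nonneg t24
  have ht25 := sq_nonneg t25
  have ht26 := sq_nonneg t26
  refine ⟨?_, ?_, ?_, ?_, ?_, ?_, ?_, ?_, ?_, ?_, ?_, ?_, ?_, ?_, ?_, ?_, ?_, ?_, ?_, ?_, ?_, ?_, ?_, ?_, ?_, ?_, ?_⟩ <;>
    exact pow_eq_zero_iff (two_ne_zero) |>.1 (le_antisymm (by linarith) (sq_nonneg _))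

/-- Coordinates vanish if the sum of squares is nonpositive. -/
theorem coord_zero (a b c x0 x1 x2 x3 x4 x5 x6 x7 y0 y1 y2 y3 y4 y5 y6 y7 z0 z1 z2 z3 z4 z5 z6 z7 : ℚ)
    (h : 5 * (z7 + 1/5 * z6 + 1/5 * z5 + 1/5 * z4 + 1/5 * z3 + 1/5 * z2 + 1/5 * z1 + 1/5 * z0 + 2/5 * y5 + 2/5 * y4 + 2/5 * y1 + 2/5 * y0 + 2/5 * x6 + 2/5 * x3 + 2/5 * x2 + 2/5 * x0 - 1/5 * c - 2/5 * b - 2/5 * a) ^ 2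
      + 24/5 * (z6 + 1/6 * z5 + 1/6 * z4 + 1/6 * z3 + 1/6 * z2 + 1/6 * z1 + 1/6 * z0 + 5/12 * y7 - 1/12 * y5 + 1/3 * y4 + 5/12 * y3 - 1/12 * y1 + 1/3 * y0 - 1/12 * x6 + 5/12 * x5 - 1/12 * x3 + 1/3 * x2 + 5/12 * x1 + 1/3 * x0 - 1/6 * c - 1/3 * b - 1/3 * a) ^ 2
      + 14/3 * (z5 + 1/7 * z4 + 1/7 * z3 + 1/7 * z2 + 1/7 * z1 + 1/7 * z0 - 1/14 * y7 + 3/7 * y6 - 1/14 * y5 + 2/7 * y4 - 1/14 * y3 + 3/7 * y2 - 1/14 * y1 + 2/7 * y0 + 3/7 * x7 - 1/14 * x6 - 1/14 * x5 + 5/14 * x3 - 1/7 * x2 + 5/14 * x1 + 2/7 * x0 - 1/7 * c - 2/7 * b - 2/7 * a) ^ 2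
      + 32/7 * (z4 + 1/8 * z3 + 1/8 * z2 + 1/8 * z1 + 1/8 * z0 - 1/16 * y7 - 1/16 * y6 - 1/16 * y5 - 3/16 * y4 + 3/8 * y3 + 3/8 * y2 + 3/8 * y1 + 1/4 * y0 + 3/8 * x7 + 3/8 * x6 + 3/8 * x5 - 1/8 * x3 - 1/8 * x2 - 1/8 * x1 + 1/4 * x0 - 1/8 * c - 1/4 * b - 1/4 * a) ^ 2
      + 9/2 * (z3 + 1/9 * z2 + 1/9 * z1 + 1/9 * z0 + 7/18 * y7 - 1/18 * y6 + 7/18 * y5 - 1/6 * y4 - 1/9 * y3 + 1/3 * y2 - 1/9 * y1 + 2/9 * y0 - 1/9 * x7 + 1/3 * x6 - 1/9 * x5 + 4/9 * x4 - 1/9 * x3 - 1/9 * x2 + 1/3 * x1 + 2/9 * x0 - 1/9 * c - 2/9 * b - 2/9 * a) ^ 2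
      + 40/9 * (z2 + 1/10 * z1 + 1/10 * z0 + 7/20 * y7 + 2/5 * y6 - 1/10 * y5 - 3/20 * y4 - 1/10 * y3 - 3/20 * y2 + 7/20 * y1 + 1/5 * y0 - 1/10 * x7 - 3/20 * x6 + 7/20 * x5 + 2/5 * x4 + 7/20 * x3 - 1/10 * x2 - 3/20 * x1 + 1/5 * x0 - 1/10 * c - 1/5 * b - 1/5 * a) ^ 2
      + 22/5 * (z1 + 1/11 * z0 - 3/22 * y7 + 4/11 * y6 + 4/11 * y5 - 3/22 * y4 + 4/11 * y3 - 3/22 * y2 - 3/22 * y1 + 2/11 * y0 + 4/11 * x7 - 3/22 * x6 - 3/22 * x5 + 4/11 * x4 - 3/22 * x3 + 4/11 * x2 - 3/22 * x1 + 2/11 * x0 - 1/11 * c - 2/11 * b - 2/11 * a) ^ 2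
      + 48/11 * (z0 + 1/3 * y7 + 1/3 * y6 + 1/3 * y5 + 1/3 * y4 + 1/3 * y3 + 1/3 * y2 + 1/3 * y1 + 1/6 * y0 + 1/3 * x7 + 1/3 * x6 + 1/3 * x5 + 1/3 * x4 + 1/3 * x3 + 1/3 * x2 + 1/3 * x1 + 1/6 * x0 - 13/24 * c - 1/6 * b - 1/6 * a) ^ 2
      + 7/3 * (y7 + 1/7 * y6 + 1/7 * y5 + 1/7 * y4 + 1/7 * y3 + 1/7 * y2 + 1/7 * y1 - 1/7 * y0 + 1/7 * x7 - 2/7 * x6 + 1/7 * x5 + 1/7 * x4 - 2/7 * x3 - 2/7 * x2 + 1/7 * x1 + 2/7 * x0 - 2/7 * c + 1/7 * b - 2/7 * a) ^ 2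
      + 16/7 * (y6 + 1/8 * y5 + 1/8 * y4 + 1/8 * y3 + 1/8 * y2 + 1/8 * y1 - 1/8 * y0 + 1/8 * x7 + 3/16 * x6 - 5/16 * x5 + 1/8 * x4 + 3/16 * x3 - 1/4 * x2 - 5/16 * x1 + 1/4 * x0 - 1/4 * c + 1/8 * b - 1/4 * a) ^ 2
      + 9/4 * (y5 + 1/9 * y4 + 1/9 * y3 + 1/9 * y2 + 1/9 * y1 - 1/9 * y0 - 1/3 * x7 + 1/6 * x6 + 1/6 * x5 + 1/9 * x4 - 5/18 * x3 + 2/9 * x2 - 5/18 * x1 + 2/9 * x0 - 2/9 * c + 1/9 * b - 2/9 * a) ^ 2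
      + 20/9 * (y4 + 1/10 * y3 + 1/10 * y2 + 1/10 * y1 - 1/10 * y0 - 3/10 * x7 - 3/10 * x6 - 3/10 * x5 + 1/10 * x4 + 1/5 * x3 + 1/5 * x2 + 1/5 * x1 + 1/5 * x0 - 1/5 * c + 1/10 * b - 1/5 * a) ^ 2
      + 11/5 * (y3 + 1/11 * y2 + 1/11 * y1 - 1/11 * y0 + 2/11 * x7 - 3/11 * x6 + 2/11 * x5 - 4/11 * x4 + 2/11 * x3 + 2/11 * x2 - 3/11 * x1 + 2/11 * x0 - 2/11 * c + 1/11 * b - 2/11 * a) ^ 2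
      + 24/11 * (y2 + 1/12 * y1 - 1/12 * y0 + 1/6 * x7 + 5/24 * x6 - 7/24 * x5 - 1/3 * x4 - 7/24 * x3 + 1/6 * x2 + 5/24 * x1 + 1/6 * x0 - 1/6 * c + 1/12 * b - 1/6 * a) ^ 2
      + 13/6 * (y1 - 1/13 * y0 - 4/13 * x7 + 5/26 * x6 + 5/26 * x5 - 4/13 * x4 + 5/26 * x3 - 4/13 * x2 + 5/26 * x1 + 2/13 * x0 - 2/13 * c + 1/13 * b - 2/13 * a) ^ 2
      + 28/13 * (y0 + 2/7 * x7 + 2/7 * x6 + 2/7 * x5 + 2/7 * x4 + 2/7 * x3 + 2/7 * x2 + 2/7 * x1 - 1/7 * x0 - 9/28 * c - 1/14 * b + 1/7 * a) ^ 2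
      + 9/7 * (x7 + 2/9 * x6 + 2/9 * x5 + 2/9 * x4 + 2/9 * x3 + 2/9 * x2 + 2/9 * x1 - 1/9 * x0 - 4/9 * c - 4/9 * b + 1/9 * a) ^ 2
      + 11/9 * (x6 + 2/11 * x5 + 2/11 * x4 + 2/11 * x3 + 2/11 * x2 + 2/11 * x1 - 1/11 * x0 - 4/11 * c - 4/11 * b + 1/11 * a) ^ 2
      + 13/11 * (x5 + 2/13 * x4 + 2/13 * x3 + 2/13 * x2 + 2/13 * x1 - 1/13 * x0 - 4/13 * c - 4/13 * b + 1/13 * a) ^ 2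
      + 15/13 * (x4 + 2/15 * x3 + 2/15 * x2 + 2/15 * x1 - 1/15 * x0 - 4/15 * c - 4/15 * b + 1/15 * a) ^ 2
      + 17/15 * (x3 + 2/17 * x2 + 2/17 * x1 - 1/17 * x0 - 4/17 * c - 4/17 * b + 1/17 * a) ^ 2
      + 19/17 * (x2 + 2/19 * x1 - 1/19 * x0 - 4/19 * c - 4/19 * b + 1/19 * a) ^ 2
      + 21/19 * (x1 - 1/21 * x0 - 4/21 * c - 4/21 * b + 1/21 * a) ^ 2
      + 32/21 * (x0 + 1/16 * c + 1/16 * b + 5/16 * a) ^ 2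
      + 3/8 * (c - 1/3 * b - 1/3 * a) ^ 2
      + 1/3 * (b - 1/2 * a) ^ 2
      + 1/4 * (a) ^ 2 ≤ 0) :
    a = 0 ∧ b = 0 ∧ c = 0 ∧ x0 = 0 ∧ x1 = 0 ∧ x2 = 0 ∧ x3 = 0 ∧ x4 = 0 ∧ x5 = 0 ∧ x6 = 0 ∧ x7 = 0 ∧ y0 = 0 ∧ y1 = 0 ∧ y2 = 0 ∧ y3 = 0 ∧ y4 = 0 ∧ y5 = 0 ∧ y6 = 0 ∧ y7 = 0 ∧ z0 = 0 ∧ z1 = 0 ∧ z2 = 0 ∧ z3 = 0 ∧ z4 = 0 ∧ z5 = 0 ∧ z6 = 0 ∧ z7 = 0 := by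
  obtain ⟨ht0, ht1, ht2, ht3, ht4, ht5, ht6, ht7, ht8, ht9, ht10, ht11, ht12, ht13, ht14, ht15, ht16, ht17, ht18, ht19, ht20, ht21, ht22, ht23, ht24, ht25, ht26⟩ :=
    sum_sq_aux _ _ _ _ _ _ _ _ _ _ _ _ _ _ _ _ _ _ _ _ _ _ _ _ _ _ _ h
  clear h
  have h_a : a = 0 := by linarith only [ht26]
  have h_b : b = 0 := by linarith only [ht25, h_a]
  have h_c : c = 0 := by linarith only [ht24, h_a, h_b]
  have h_x0 : x0 = 0 := by linarith only [ht23, h_a, h_b, h_c]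
  have h_x1 : x1 = 0 := by linarith only [ht22, h_a, h_b, h_c, h_x0]
  have h_x2 : x2 = 0 := by linarith only [ht21, h_a, h_b, h_c, h_x0, h_x1]
  have h_x3 : x3 = 0 := by linarith only [ht20, h_a, h_b, h_c, h_x0, h_x1, h_x2]
  have h_x4 : x4 = 0 := by linarith only [ht19, h_a, h_b, h_c, h_x0, h_x1, h_x2, h_x3]
  have h_x5 : x5 = 0 := by linarith only [ht18, h_a, h_b, h_c, h_x0, h_x1, h_x2, h_x3, h_x4]
  have h_x6 : x6 = 0 := by linarith only [ht17, h_a, h_b, h_c, h_x0, h_x1, h_x2, h_x3, h_x4, h_x5]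
  have h_x7 : x7 = 0 := by linarith only [ht16, h_a, h_b, h_c, h_x0, h_x1, h_x2, h_x3, h_x4, h_x5, h_x6]
  have h_y0 : y0 = 0 := by linarith only [ht15, h_a, h_b, h_c, h_x0, h_x1, h_x2, h_x3, h_x4, h_x5, h_x6, h_x7]
  have h_y1 : y1 = 0 := by linarith only [ht14, h_a, h_b, h_c, h_x0, h_x1, h_x2, h_x3, h_x4, h_x5, h_x6, h_x7, h_y0]
  have h_y2 : y2 = 0 := by linarith only [ht13, h_a, h_b, h_c, h_x0, h_x1, h_x2, h_x3, h_x4, h_x5, h_x6, h_x7, h_y0, h_y1]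
  have h_y3 : y3 = 0 := by linarith only [ht12, h_a, h_b, h_c, h_x0, h_x1, h_x2, h_x3, h_x4, h_x5, h_x6, h_x7, h_y0, h_y1, h_y2]
  have h_y4 : y4 = 0 := by linarith only [ht11, h_a, h_b, h_c, h_x0, h_x1, h_x2, h_x3, h_x4, h_x5, h_x6, h_x7, h_y0, h_y1, h_y2, h_y3]
  have h_y5 : y5 = 0 := by linarith only [ht10, h_a, h_b, h_c, h_x0, h_x1, h_x2, h_x3, h_x4, h_x5, h_x6, h_x7, h_y0, h_y1, h_y2, h_y3, h_y4]
  have h_y6 : y6 = 0 := by linarith only [ht9, h_a, h_b, h_c, h_x0, h_x1, h_x2, h_x3, h_x4, h_x5, h_x6, h_x7, h_y0, h_y1, h_y2, h_y3, h_y4, h_y5]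
  have h_y7 : y7 = 0 := by linarith only [ht8, h_a, h_b, h_c, h_x0, h_x1, h_x2, h_x3, h_x4, h_x5, h_x6, h_x7, h_y0, h_y1, h_y2, h_y3, h_y4, h_y5, h_y6]
  have h_z0 : z0 = 0 := by linarith only [ht7, h_a, h_b, h_c, h_x0, h_x1, h_x2, h_x3, h_x4, h_x5, h_x6, h_x7, h_y0, h_y1, h_y2, h_y3, h_y4, h_y5, h_y6, h_y7]
  have h_z1 : z1 = 0 := by linarith only [ht6, h_a, h_b, h_c, h_x0, h_x1, h_x2, h_x3, h_x4, h_x5, h_x6, h_x7, h_y0, h_y1, h_y2, h_y3, h_y4, h_y5, h_y6, h_y7, h_z0]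
  have h_z2 : z2 = 0 := by linarith only [ht5, h_a, h_b, h_c, h_x0, h_x1, h_x2, h_x3, h_x4, h_x5, h_x6, h_x7, h_y0, h_y1, h_y2, h_y3, h_y4, h_y5, h_y6, h_y7, h_z0, h_z1]
  have h_z3 : z3 = 0 := by linarith only [ht4, h_a, h_b, h_c, h_x0, h_x1, h_x2, h_x3, h_x4, h_x5, h_x6, h_x7, h_y0, h_y1, h_y2, h_y3, h_y4, h_y5, h_y6, h_y7, h_z0, h_z1, h_z2]
  have h_z4 : z4 = 0 := by linarith only [ht3, h_a, h_b, h_c, h_x0, h_x1, h_x2, h_x3, h_x5, h_x6, h_x7, h_y0, h_y1, h_y2, h_y3, h_y4, h_y5, h_y6, h_y7, h_z0, h_z1, h_z2, h_z3]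
  have h_z5 : z5 = 0 := by linarith only [ht2, h_a, h_b, h_c, h_x0, h_x1, h_x2, h_x3, h_x5, h_x6, h_x7, h_y0, h_y1, h_y2, h_y3, h_y4, h_y5, h_y6, h_y7, h_z0, h_z1, h_z2, h_z3, h_z4]
  have h_z6 : z6 = 0 := by linarith only [ht1, h_a, h_b, h_c, h_x0, h_x1, h_x2, h_x3, h_x5, h_x6, h_y0, h_y1, h_y3, h_y4, h_y5, h_y7, h_z0, h_z1, h_z2, h_z3, h_z4, h_z5]
  have h_z7 : z7 = 0 := by linarith only [ht0, h_a, h_b, h_c, h_x0, h_x2, h_x3, h_x6, h_y0, h_y1, h_y4, h_y5, h_z0, h_z1, h_z2, h_z3, h_z4, h_z5, h_z6]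
  exact ⟨h_a, h_b, h_c, h_x0, h_x1, h_x2, h_x3, h_x4, h_x5, h_x6, h_x7, h_y0, h_y1, h_y2, h_y3, h_y4, h_y5, h_y6, h_y7, h_z0, h_z1, h_z2, h_z3, h_z4, h_z5, h_z6, h_z7⟩

/-- Coordinate expression of the octonion trilinear form. -/
theorem otri_coord (x y z : O) :
    otri x y z =
      2 * (x.1.re * y.1.re * z.1.re - x.1.re * y.1.imI * z.1.imI - x.1.re * y.1.imJ * z.1.imJ - x.1.re * y.1.imK * z.1.imK - x.1.re * y.2.re * z.2.re - 
        x.1.re * y.2.imI * z.2.imI - x.1.re * y.2.imJ * z.2.imJ - x.1.re * y.2.imK * z.2.imK - x.1.imI * y.1.re * z.1.imI - x.1.imI * y.1.imI * z.1.re - x.1.imI * y.1.imJ * z.1.imK + 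
        x.1.imI * y.1.imK * z.1.imJ - x.1.imI * y.2.re * z.2.imI + x.1.imI * y.2.imI * z.2.re + x.1.imI * y.2.imJ * z.2.imK - x.1.imI * y.2.imK * z.2.imJ - x.1.imJ * y.1.re * z.1.imJ + 
        x.1.imJ * y.1.imI * z.1.imK - x.1.imJ * y.1.imJ * z.1.re - x.1.imJ * y.1.imK * z.1.imI - x.1.imJ * y.2.re * z.2.imJ - x.1.imJ * y.2.imI * z.2.imK + x.1.imJ * y.2.imJ * z.2.re + 
        x.1.imJ * y.2.imK * z.2.imI - x.1.imK * y.1.re * z.1.imK - x.1.imK * y.1.imI * z.1.imJ + x.1.imK * y.1.imJ * z.1.imI - x.1.imK * y.1.imK * z.1.re - x.1.imK * y.2.re * z.2.imK + 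
        x.1.imK * y.2.imI * z.2.imJ - x.1.imK * y.2.imJ * z.2.imI + x.1.imK * y.2.imK * z.2.re - x.2.re * y.1.re * z.2.re + x.2.re * y.1.imI * z.2.imI + x.2.re * y.1.imJ * z.2.imJ + 
        x.2.re * y.1.imK * z.2.imK - x.2.re * y.2.re * z.1.re - x.2.re * y.2.imI * z.1.imI - x.2.re * y.2.imJ * z.1.imJ - x.2.re * y.2.imK * z.1.imK - x.2.imI * y.1.re * z.2.imI - 
        x.2.imI * y.1.imI * z.2.re + x.2.imI * y.1.imJ * z.2.imK - x.2.imI * y.1.imK * z.2.imJ + x.2.imI * y.2.re * z.1.imI - x.2.imI * y.2.imI * z.1.re + x.2.imI * y.2.imJ * z.1.imK - 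
        x.2.imI * y.2.imK * z.1.imJ - x.2.imJ * y.1.re * z.2.imJ - x.2.imJ * y.1.imI * z.2.imK - x.2.imJ * y.1.imJ * z.2.re + x.2.imJ * y.1.imK * z.2.imI + x.2.imJ * y.2.re * z.1.imJ - 
        x.2.imJ * y.2.imI * z.1.imK - x.2.imJ * y.2.imJ * z.1.re + x.2.imJ * y.2.imK * z.1.imI - x.2.imK * y.1.re * z.2.imK + x.2.imK * y.1.imI * z.2.imJ - x.2.imK * y.1.imJ * z.2.imI - 
        x.2.imK * y.1.imK * z.2.re + x.2.imK * y.2.re * z.1.imK + x.2.imK * y.2.imI * z.1.imJ - x.2.imK * y.2.imJ * z.1.imI - x.2.imK * y.2.imK * z.1.re) := by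
  simp only [otri, otr, omul, Quaternion.re_add, Quaternion.re_sub, Quaternion.re_mul,
    Quaternion.imI_add, Quaternion.imI_sub, Quaternion.imI_mul,
    Quaternion.imJ_add, Quaternion.imJ_sub, Quaternion.imJ_mul,
    Quaternion.imK_add, Quaternion.imK_sub, Quaternion.imK_mul,
    Quaternion.re_star, Quaternion.imI_star, Quaternion.imJ_star, Quaternion.imK_star]
  ring

/-- Coordinate expression of the octonion norm. -/
theorem onorm_coord (x : O) :
    onorm x = x.1.re ^ 2 + x.1.imI ^ 2 + x.1.imJ ^ 2 + x.1.imK ^ 2 + x.2.re ^ 2 + x.2.imI ^ 2 + x.2.imJ ^ 2 + x.2.imK ^ 2 := by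
  simp only [onorm, Quaternion.normSq_def']
  ring

set_option maxHeartbeats 4000000 in
/-- The form `(X,X)_E` as a weighted sum of squares. -/
theorem pairE_sum_sq (a b c : ℚ) (x y z : O) :
    pairU EJ (a, b, c, x, y, z) (a, b, c, x, y, z) =
      5 * (z.2.imK + 1/5 * z.2.imJ + 1/5 * z.2.imI + 1/5 * z.2.re + 1/5 * z.1.imK + 1/5 * z.1.imJ + 1/5 * z.1.imI + 1/5 * z.1.re + 2/5 * y.2.imI + 2/5 * y.2.re + 2/5 * y.1.imI + 2/5 * y.1.re + 2/5 * x.2.imJ + 2/5 * x.1.imK + 2/5 * x.1.imJ + 2/5 * x.1.re - 1/5 * c - 2/5 * b - 2/5 * a) ^ 2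
      + 24/5 * (z.2.imJ + 1/6 * z.2.imI + 1/6 * z.2.re + 1/6 * z.1.imK + 1/6 * z.1.imJ + 1/6 * z.1.imI + 1/6 * z.1.re + 5/12 * y.2.imK - 1/12 * y.2.imI + 1/3 * y.2.re + 5/12 * y.1.imK - 1/12 * y.1.imI + 1/3 * y.1.re - 1/12 * x.2.imJ + 5/12 * x.2.imI - 1/12 * x.1.imK + 1/3 * x.1.imJ + 5/12 * x.1.imI + 1/3 * x.1.re - 1/6 * c - 1/3 * b - 1/3 * a) ^ 2
      + 14/3 * (z.2.imI + 1/7 * z.2.re + 1/7 * z.1.imK + 1/7 * z.1.imJ + 1/7 * z.1.imI + 1/7 * z.1.re - 1/14 * y.2.imK + 3/7 * y.2.imJ - 1/14 * y.2.imI + 2/7 * y.2.re - 1/14 * y.1.imK + 3/7 * y.1.imJ - 1/14 * y.1.imI + 2/7 * y.1.re + 3/7 * x.2.imK - 1/14 * x.2.imJ - 1/14 * x.2.imI + 5/14 * x.1.imK - 1/7 * x.1.imJ + 5/14 * x.1.imI + 2/7 * x.1.re - 1/7 * c - 2/7 * b - 2/7 * a) ^ 2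
      + 32/7 * (z.2.re + 1/8 * z.1.imK + 1/8 * z.1.imJ + 1/8 * z.1.imI + 1/8 * z.1.re - 1/16 * y.2.imK - 1/16 * y.2.imJ - 1/16 * y.2.imI - 3/16 * y.2.re + 3/8 * y.1.imK + 3/8 * y.1.imJ + 3/8 * y.1.imI + 1/4 * y.1.re + 3/8 * x.2.imK + 3/8 * x.2.imJ + 3/8 * x.2.imI - 1/8 * x.1.imK - 1/8 * x.1.imJ - 1/8 * x.1.imI + 1/4 * x.1.re - 1/8 * c - 1/4 * b - 1/4 * a) ^ 2
      + 9/2 * (z.1.imK + 1/9 * z.1.imJ + 1/9 * z.1.imI + 1/9 * z.1.re + 7/18 * y.2.imK - 1/18 * y.2.imJ + 7/18 * y.2.imI - 1/6 * y.2.re - 1/9 * y.1.imK + 1/3 * y.1.imJ - 1/9 * y.1.imI + 2/9 * y.1.re - 1/9 * x.2.imK + 1/3 * x.2.imJ - 1/9 * x.2.imI + 4/9 * x.2.re - 1/9 * x.1.imK - 1/9 * x.1.imJ + 1/3 * x.1.imI + 2/9 * x.1.re - 1/9 * c - 2/9 * b - 2/9 * a) ^ 2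
      + 40/9 * (z.1.imJ + 1/10 * z.1.imI + 1/10 * z.1.re + 7/20 * y.2.imK + 2/5 * y.2.imJ - 1/10 * y.2.imI - 3/20 * y.2.re - 1/10 * y.1.imK - 3/20 * y.1.imJ + 7/20 * y.1.imI + 1/5 * y.1.re - 1/10 * x.2.imK - 3/20 * x.2.imJ + 7/20 * x.2.imI + 2/5 * x.2.re + 7/20 * x.1.imK - 1/10 * x.1.imJ - 3/20 * x.1.imI + 1/5 * x.1.re - 1/10 * c - 1/5 * b - 1/5 * a) ^ 2
      + 22/5 * (z.1.imI + 1/11 * z.1.re - 3/22 * y.2.imK + 4/11 * y.2.imJ + 4/11 * y.2.imI - 3/22 * y.2.re + 4/11 * y.1.imK - 3/22 * y.1.imJ - 3/22 * y.1.imI + 2/11 * y.1.re + 4/11 * x.2.imK - 3/22 * x.2.imJ - 3/22 * x.2.imI + 4/11 * x.2.re - 3/22 * x.1.imK + 4/11 * x.1.imJ - 3/22 * x.1.imI + 2/11 * x.1.re - 1/11 * c - 2/11 * b - 2/11 * a) ^ 2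
      + 48/11 * (z.1.re + 1/3 * y.2.imK + 1/3 * y.2.imJ + 1/3 * y.2.imI + 1/3 * y.2.re + 1/3 * y.1.imK + 1/3 * y.1.imJ + 1/3 * y.1.imI + 1/6 * y.1.re + 1/3 * x.2.imK + 1/3 * x.2.imJ + 1/3 * x.2.imI + 1/3 * x.2.re + 1/3 * x.1.imK + 1/3 * x.1.imJ + 1/3 * x.1.imI + 1/6 * x.1.re - 13/24 * c - 1/6 * b - 1/6 * a) ^ 2
      + 7/3 * (y.2.imK + 1/7 * y.2.imJ + 1/7 * y.2.imI + 1/7 * y.2.re + 1/7 * y.1.imK + 1/7 * y.1.imJ + 1/7 * y.1.imI - 1/7 * y.1.re + 1/7 * x.2.imK - 2/7 * x.2.imJ + 1/7 * x.2.imI + 1/7 * x.2.re - 2/7 * x.1.imK - 2/7 * x.1.imJ + 1/7 * x.1.imI + 2/7 * x.1.re - 2/7 * c + 1/7 * b - 2/7 * a) ^ 2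
      + 16/7 * (y.2.imJ + 1/8 * y.2.imI + 1/8 * y.2.re + 1/8 * y.1.imK + 1/8 * y.1.imJ + 1/8 * y.1.imI - 1/8 * y.1.re + 1/8 * x.2.imK + 3/16 * x.2.imJ - 5/16 * x.2.imI + 1/8 * x.2.re + 3/16 * x.1.imK - 1/4 * x.1.imJ - 5/16 * x.1.imI + 1/4 * x.1.re - 1/4 * c + 1/8 * b - 1/4 * a) ^ 2
      + 9/4 * (y.2.imI + 1/9 * y.2.re + 1/9 * y.1.imK + 1/9 * y.1.imJ + 1/9 * y.1.imI - 1/9 * y.1.re - 1/3 * x.2.imK + 1/6 * x.2.imJ + 1/6 * x.2.imI + 1/9 * x.2.re - 5/18 * x.1.imK + 2/9 * x.1.imJ - 5/18 * x.1.imI + 2/9 * x.1.re - 2/9 * c + 1/9 * b - 2/9 * a) ^ 2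
      + 20/9 * (y.2.re + 1/10 * y.1.imK + 1/10 * y.1.imJ + 1/10 * y.1.imI - 1/10 * y.1.re - 3/10 * x.2.imK - 3/10 * x.2.imJ - 3/10 * x.2.imI + 1/10 * x.2.re + 1/5 * x.1.imK + 1/5 * x.1.imJ + 1/5 * x.1.imI + 1/5 * x.1.re - 1/5 * c + 1/10 * b - 1/5 * a) ^ 2
      + 11/5 * (y.1.imK + 1/11 * y.1.imJ + 1/11 * y.1.imI - 1/11 * y.1.re + 2/11 * x.2.imK - 3/11 * x.2.imJ + 2/11 * x.2.imI - 4/11 * x.2.re + 2/11 * x.1.imK + 2/11 * x.1.imJ - 3/11 * x.1.imI + 2/11 * x.1.re - 2/11 * c + 1/11 * b - 2/11 * a) ^ 2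
      + 24/11 * (y.1.imJ + 1/12 * y.1.imI - 1/12 * y.1.re + 1/6 * x.2.imK + 5/24 * x.2.imJ - 7/24 * x.2.imI - 1/3 * x.2.re - 7/24 * x.1.imK + 1/6 * x.1.imJ + 5/24 * x.1.imI + 1/6 * x.1.re - 1/6 * c + 1/12 * b - 1/6 * a) ^ 2
      + 13/6 * (y.1.imI - 1/13 * y.1.re - 4/13 * x.2.imK + 5/26 * x.2.imJ + 5/26 * x.2.imI - 4/13 * x.2.re + 5/26 * x.1.imK - 4/13 * x.1.imJ + 5/26 * x.1.imI + 2/13 * x.1.re - 2/13 * c + 1/13 * b - 2/13 * a) ^ 2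
      + 28/13 * (y.1.re + 2/7 * x.2.imK + 2/7 * x.2.imJ + 2/7 * x.2.imI + 2/7 * x.2.re + 2/7 * x.1.imK + 2/7 * x.1.imJ + 2/7 * x.1.imI - 1/7 * x.1.re - 9/28 * c - 1/14 * b + 1/7 * a) ^ 2
      + 9/7 * (x.2.imK + 2/9 * x.2.imJ + 2/9 * x.2.imI + 2/9 * x.2.re + 2/9 * x.1.imK + 2/9 * x.1.imJ + 2/9 * x.1.imI - 1/9 * x.1.re - 4/9 * c - 4/9 * b + 1/9 * a) ^ 2
      + 11/9 * (x.2.imJ + 2/11 * x.2.imI + 2/11 * x.2.re + 2/11 * x.1.imK + 2/11 * x.1.imJ + 2/11 * x.1.imI - 1/11 * x.1.re - 4/11 * c - 4/11 * b + 1/11 * a) ^ 2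
      + 13/11 * (x.2.imI + 2/13 * x.2.re + 2/13 * x.1.imK + 2/13 * x.1.imJ + 2/13 * x.1.imI - 1/13 * x.1.re - 4/13 * c - 4/13 * b + 1/13 * a) ^ 2
      + 15/13 * (x.2.re + 2/15 * x.1.imK + 2/15 * x.1.imJ + 2/15 * x.1.imI - 1/15 * x.1.re - 4/15 * c - 4/15 * b + 1/15 * a) ^ 2
      + 17/15 * (x.1.imK + 2/17 * x.1.imJ + 2/17 * x.1.imI - 1/17 * x.1.re - 4/17 * c - 4/17 * b + 1/17 * a) ^ 2
      + 19/17 * (x.1.imJ + 2/19 * x.1.imI - 1/19 * x.1.re - 4/19 * c - 4/19 * b + 1/19 * a) ^ 2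
      + 21/19 * (x.1.imI - 1/21 * x.1.re - 4/21 * c - 4/21 * b + 1/21 * a) ^ 2
      + 32/21 * (x.1.re + 1/16 * c + 1/16 * b + 5/16 * a) ^ 2
      + 3/8 * (c - 1/3 * b - 1/3 * a) ^ 2
      + 1/3 * (b - 1/2 * a) ^ 2
      + 1/4 * (a) ^ 2 := by
  have hβ0 : βO.1.re = -1/2 := rfl
  have hβ1 : βO.1.imI = 1/2 := rfl
  have hβ2 : βO.1.imJ = 1/2 := rfl
  have hβ3 : βO.1.imK = 1/2 := rfl
  have hβ4 : βO.2.re = 1/2 := rfl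
  have hβ5 : βO.2.imI = 1/2 := rfl
  have hβ6 : βO.2.imJ = 1/2 := rfl
  have hβ7 : βO.2.imK = 1/2 := rfl
  simp only [pairU, pairSharp, triJ, EJ, mkJ, Prod.mk_add_mk, NJ, otri_coord, onorm_coord,
    Prod.fst_add, Prod.snd_add, Quaternion.re_add, Quaternion.imI_add, Quaternion.imJ_add,
    Quaternion.imK_add, hβ0, hβ1, hβ2, hβ3, hβ4, hβ5, hβ6, hβ7]
  generalize x.1.re = x0
  generalize x.1.imI = x1
  generalize x.1.imJ = x2
  generalize x.1.imK = x3
  generalize x.2.re = x4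
  generalize x.2.imI = x5
  generalize x.2.imJ = x6
  generalize x.2.imK = x7
  generalize y.1.re = y0
  generalize y.1.imI = y1
  generalize y.1.imJ = y2
  generalize y.1.imK = y3
  generalize y.2.re = y4
  generalize y.2.imI = y5
  generalize y.2.imJ = y6
  generalize y.2.imK = y7
  generalize z.1.re = z0
  generalize z.1.imI = z1
  generalize z.1.imJ = z2
  generalize z.1.imK = z3
  generalize z.2.re = z4
  generalize z.2.imI = z5
  generalize z.2.imJ = z6
  generalize z.2.imK = z7
  ring

/-- For `U = E = [2,2,2;β,β,β]` (which has `N_J(E) = 1`), the quadratic form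
`X ↦ (X,X)_E` is positive-definite on `J = H₃(O)`. -/
theorem pairE_positive_definite (hE : NJ EJ = 1) (X : Jt) (hX : X ≠ 0) :
    0 < pairU EJ X X := by
  obtain ⟨a, b, c, x, y, z⟩ := X
  by_contra hneg
  have hle := not_lt.1 hneg
  rw [pairE_sum_sq] at hle
  obtain ⟨h_a, h_b, h_c, h_x0, h_x1, h_x2, h_x3, h_x4, h_x5, h_x6, h_x7, h_y0, h_y1, h_y2, h_y3, h_y4, h_y5, h_y6, h_y7, h_z0, h_z1, h_z2, h_z3, h_z4, h_z5, h_z6, h_z7⟩ :=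
    coord_zero _ _ _ _ _ _ _ _ _ _ _ _ _ _ _ _ _ _ _ _ _ _ _ _ _ _ _ hle
  have h_x : x = 0 := Prod.ext (Quaternion.ext _ _ h_x0 h_x1 h_x2 h_x3)
    (Quaternion.ext _ _ h_x4 h_x5 h_x6 h_x7)
  have h_y : y = 0 := Prod.ext (Quaternion.ext _ _ h_y0 h_y1 h_y2 h_y3)
    (Quaternion.ext _ _ h_y4 h_y5 h_y6 h_y7)
  have h_z : z = 0 := Prod.ext (Quaternion.ext _ _ h_z0 h_z1 h_z2 h_z3)
    (Quaternion.ext _ _ h_z4 h_z5 h_z6 h_z7)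
  apply hX
  rw [h_a, h_b, h_c, h_x, h_y, h_z]
  rfl
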